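/- Let A be an n×n real symmetric positive semidefinite matrix with trace 1, let α > 0 with α ≠ 1, and let k be an integer with 1 ≤ k ≤ n−1. Then the low-rank Rényi entropy dominates the full matrix-based Rényi entropy: S_α^k(A) ≥ S_α(A). -/

import Mathlib

open scoped BigOperators

/-- The eigenvalues of a real symmetric matrix, sorted in nonincreasing order
    (returns `0` if the matrix is not symmetric). -/
noncomputable def eigs {n : ℕ} (A : Matrix (Fin n) (Fin n) ℝ) : Fin n → ℝ :=
  if h : A.IsHermitian then
    fun i => (h.eigenvalues ∘ Tuple.sort h.eigenvalues) i.rev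
  else 0

/-- The sum of `f i` over the indices `i < k` (the `k` largest eigenvalues when
    `f` is nonincreasing). -/
noncomputable def topSum {n : ℕ} (k : ℕ) (f : Fin n → ℝ) : ℝ :=
  ∑ i ∈ Finset.univ.filter fun i : Fin n => (i : ℕ) < k, f i

/-- `λ_r(A) = (1 - ∑_{i=1}^k λ_i(A)) / (n - k)`. -/
noncomputable def lamR {n : ℕ} (k : ℕ) (A : Matrix (Fin n) (Fin n) ℝ) : ℝ :=
  (1 - topSum k (eigs A)) / ((n : ℝ) - (k : ℝ))

/-- Low-rank matrix-based Rényi entropy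
    `S_α^k(A) = (1/(1-α)) log₂(∑_{i=1}^k λ_i(A)^α + (n-k) λ_r(A)^α)`. -/
noncomputable def Slow {n : ℕ} (α : ℝ) (k : ℕ) (A : Matrix (Fin n) (Fin n) ℝ) : ℝ :=
  (1 / (1 - α)) * Real.logb 2
    (topSum k (fun i => eigs A i ^ α) + ((n : ℝ) - (k : ℝ)) * lamR k A ^ α)

/-- Matrix-based Rényi entropy `S_α(A) = (1/(1-α)) log₂(∑_{i=1}^n λ_i(A)^α)`. -/
noncomputable def Sfull {n : ℕ} (α : ℝ) (A : Matrix (Fin n) (Fin n) ℝ) : ℝ :=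
  (1 / (1 - α)) * Real.logb 2 (∑ i, eigs A i ^ α)

lemma Finset.sum_rpow_le_card_mul_rpow_mean {ι : Type*} {s : Finset ι} (hs : s.Nonempty)
    {f : ι → ℝ} (hf : ∀ i ∈ s, 0 ≤ f i) {p : ℝ} (hp0 : 0 ≤ p) (hp1 : p ≤ 1) :
    ∑ i ∈ s, f i ^ p ≤ (s.card : ℝ) * ((∑ i ∈ s, f i) / s.card) ^ p := by
  have hc : (0 : ℝ) < s.card := by exact_mod_cast hs.card_pos
  have h := (Real.concaveOn_rpow hp0 hp1).le_map_sum (t := s) (w := fun _ => (s.card : ℝ)⁻¹)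
    (p := f) (fun _ _ => by positivity) (by simp [hc.ne']) hf
  simp only [smul_eq_mul, ← Finset.mul_sum] at h
  rwa [inv_mul_le_iff₀ hc, inv_mul_eq_div] at h

lemma Finset.card_mul_rpow_mean_le_sum_rpow {ι : Type*} {s : Finset ι} (hs : s.Nonempty)
    {f : ι → ℝ} (hf : ∀ i ∈ s, 0 ≤ f i) {p : ℝ} (hp : 1 ≤ p) :
    (s.card : ℝ) * ((∑ i ∈ s, f i) / s.card) ^ p ≤ ∑ i ∈ s, f i ^ p := by
  have hc : (0 : ℝ) < s.card := by exact_mod_cast hs.card_pos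
  have h := (convexOn_rpow hp).map_sum_le (t := s) (w := fun _ => (s.card : ℝ)⁻¹)
    (p := f) (fun _ _ => by positivity) (by simp [hc.ne']) hf
  simp only [smul_eq_mul, ← Finset.mul_sum] at h
  rwa [le_inv_mul_iff₀ hc, inv_mul_eq_div] at h

lemma Finset.sum_rpow_pos {ι : Type*} {s : Finset ι} {f : ι → ℝ} (hf : ∀ i ∈ s, 0 ≤ f i)
    (hsum : 0 < ∑ i ∈ s, f i) (p : ℝ) : 0 < ∑ i ∈ s, f i ^ p := by
  obtain ⟨i, hi, hpos⟩ := Finset.exists_lt_of_sum_lt (s := s) (f := fun _ => (0 : ℝ)) (g := f)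
    (by simpa using hsum)
  exact Finset.sum_pos' (fun j hj => Real.rpow_nonneg (hf j hj) p)
    ⟨i, hi, Real.rpow_pos_of_pos hpos p⟩

lemma eigs_nonneg {n : ℕ} {A : Matrix (Fin n) (Fin n) ℝ} (hA : A.PosSemidef) (i : Fin n) :
    0 ≤ eigs A i := by
  simp only [eigs, dif_pos hA.isHermitian]
  exact hA.eigenvalues_nonneg _

lemma sum_eigs {n : ℕ} {A : Matrix (Fin n) (Fin n) ℝ} (hA : A.IsHermitian) :
    ∑ i, eigs A i = A.trace := by
  rw [hA.trace_eq_sum_eigenvalues]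
  simp only [eigs, dif_pos hA]
  exact Equiv.sum_comp (Fin.revPerm.trans (Tuple.sort hA.eigenvalues)) hA.eigenvalues

lemma topSum_add_sum_compl {n : ℕ} (k : ℕ) (f : Fin n → ℝ) :
    topSum k f + ∑ i ∈ Finset.univ.filter (fun i : Fin n => ¬ (i : ℕ) < k), f i = ∑ i, f i :=
  Finset.sum_filter_add_sum_filter_not _ _ _

lemma card_filter_not_val_lt {n k : ℕ} (hk : k ≤ n) :
    ((Finset.univ.filter (fun i : Fin n => ¬ (i : ℕ) < k)).card : ℝ) = (n : ℝ) - k := by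
  have h := Finset.card_filter_add_card_filter_not (s := (Finset.univ : Finset (Fin n)))
    (fun i : Fin n => (i : ℕ) < k)
  rw [Fin.card_filter_val_lt, min_eq_right hk, Finset.card_univ, Fintype.card_fin] at h
  rw [eq_sub_iff_add_eq']
  exact_mod_cast h

/-- the low-rank Rényi entropy dominates the full matrix-based Rényi
entropy: `S_α^k(A) ≥ S_α(A)`. -/
theorem lowRank_entropy_ge_full {n : ℕ} (A : Matrix (Fin n) (Fin n) ℝ)
    (α : ℝ) (k : ℕ)
    (hA : A.PosSemidef) (htr : A.trace = 1)
    (hα : 0 < α) (hα1 : α ≠ 1) (hk1 : 1 ≤ k) (hkn : k ≤ n - 1) :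
    Sfull α A ≤ Slow α k A := by
  have hlt : k < n := by omega
  have hf := eigs_nonneg hA
  have hsum : ∑ i, eigs A i = 1 := (sum_eigs hA.isHermitian).trans htr
  set t := Finset.univ.filter (fun i : Fin n => ¬ (i : ℕ) < k) with ht
  have hcard : (t.card : ℝ) = (n : ℝ) - k := card_filter_not_val_lt hlt.le
  have hc : (0 : ℝ) < (n : ℝ) - k := sub_pos.mpr (by exact_mod_cast hlt)
  have hne : t.Nonempty := ⟨⟨k, hlt⟩, by simp [ht]⟩
  have hlam : lamR k A = (∑ i ∈ t, eigs A i) / t.card := by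
    rw [lamR, hcard, ← hsum, ← topSum_add_sum_compl k, add_sub_cancel_left]
  have hsplit := topSum_add_sum_compl k (fun i => eigs A i ^ α)
  rw [Sfull, Slow, ← hcard, hlam, ← hsplit]
  rcases lt_or_gt_of_ne hα1 with h | h
  · refine mul_le_mul_of_nonneg_left (Real.logb_le_logb_of_le one_lt_two ?_ ?_)
      (one_div_nonneg.mpr (sub_nonneg.mpr h.le))
    · rw [hsplit]
      exact Finset.sum_rpow_pos (fun i _ => hf i) (hsum ▸ one_pos) α
    · gcongr
      exact Finset.sum_rpow_le_card_mul_rpow_mean hne (fun i _ => hf i) hα.le h.le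
  · refine mul_le_mul_of_nonpos_left (Real.logb_le_logb_of_le one_lt_two ?_ ?_)
      (one_div_nonpos.mpr (sub_nonpos.mpr h.le))
    · have htop : 0 ≤ topSum k (fun i => eigs A i ^ α) :=
        Finset.sum_nonneg fun i _ => Real.rpow_nonneg (hf i) α
      have htail : 0 ≤ ∑ i ∈ t, eigs A i := Finset.sum_nonneg fun i _ => hf i
      rcases htail.eq_or_lt with h0 | h0
      · have hone : topSum k (eigs A) = 1 := by
          rw [← hsum, ← topSum_add_sum_compl k, ← ht, ← h0, add_zero]
        have hpos : 0 < topSum k (fun i => eigs A i ^ α) :=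
          Finset.sum_rpow_pos (fun i _ => hf i) (hone.symm ▸ one_pos : 0 < topSum k (eigs A)) α
        positivity
      · rw [← hcard] at hc
        positivity
    · gcongr
      exact Finset.card_mul_rpow_mean_le_sum_rpow hne (fun i _ => hf i) h.le
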